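/- Let τ > 2 and let ρ_min be a minimizing measure with support M. If p ∈ M, then K(p) ∩ M is non-empty. -/

import Mathlib

open MeasureTheory Set
open scoped RealInnerProductSpace ENNReal

noncomputable section

/-- Euclidean three-space. -/
abbrev E3 := EuclideanSpace ℝ (Fin 3)

/-- The unit sphere `S² ⊂ ℝ³`. -/
def Sphere2 : Set E3 := Metric.sphere 0 1

/-- The function `D(x,y) = (1/4)(1+⟨x,y⟩)(2 − τ²(1−⟨x,y⟩))`. -/
def Dfun (τ : ℝ) (x y : E3) : ℝ :=
  (1 / 4) * (1 + ⟪x, y⟫) * (2 - τ ^ 2 * (1 - ⟪x, y⟫))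

/-- The Lagrangian `L = max(0, D)`. -/
def Lfun (τ : ℝ) (x y : E3) : ℝ := max 0 (Dfun τ x y)

/-- The causal action of a measure. -/
def causalAction (τ : ℝ) (ρ : Measure E3) : ℝ :=
  ∫ x, ∫ y, Lfun τ x y ∂ρ ∂ρ

/-- `ρ` is a minimizing measure: a regular Borel probability measure supported on `S²`
minimizing the causal action among all such measures. -/
def IsMinimizer (τ : ℝ) (ρ : Measure E3) : Prop :=
  IsProbabilityMeasure ρ ∧ ρ.Regular ∧ ρ Sphere2ᶜ = 0 ∧
    ∀ ρ' : Measure E3, IsProbabilityMeasure ρ' → ρ'.Regular → ρ' Sphere2ᶜ = 0 →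
      causalAction τ ρ ≤ causalAction τ ρ'

/-- The support of a measure. -/
def msupport (ρ : Measure E3) : Set E3 :=
  {x | ∀ U : Set E3, IsOpen U → x ∈ U → 0 < ρ U}

/-- The opening angle `θ_max = arccos(1 − 2/τ²)`. -/
def θmax (τ : ℝ) : ℝ := Real.arccos (1 - 2 / τ ^ 2)

/-- The open light cone `I(p)`. -/
def lightConeI (τ : ℝ) (p : E3) : Set E3 := {q ∈ Sphere2 | 0 < Dfun τ p q}

/-- The boundary of the light cone `K(p)`. -/
def lightConeK (τ : ℝ) (p : E3) : Set E3 :=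
  {q ∈ Sphere2 | ⟪p, q⟫ = Real.cos (θmax τ)}

/-- Make a point of `ℝ³` from coordinates. -/
def mkE3 (a b c : ℝ) : E3 := (WithLp.equiv 2 (Fin 3 → ℝ)).symm ![a, b, c]

/-- A totally timelike set. -/
def TotallyTimelike (τ : ℝ) (Ω : Set E3) : Prop := ∀ x ∈ Ω, ∀ y ∈ Ω, 0 < Dfun τ x y

/-- `p` is an accumulation point of `A`: every neighborhood of `p` contains a point
of `A` different from `p`. -/
def AccumulationPt (p : E3) (A : Set E3) : Prop :=
  ∀ U ∈ nhds p, ∃ x ∈ A, x ∈ U ∧ x ≠ p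

/-- `γ(0)` is a uniform two-sided accumulation point (of points of `M`) on `γ` of
scaling `β`, where `γ` is defined on `(−δ, δ)`. -/
def UniformTwoSidedAcc (M : Set E3) (β δ : ℝ) (γ : ℝ → E3) : Prop :=
  ∃ ε₀ : ℝ, 0 < ε₀ ∧ ε₀ < δ ∧ ∀ ε : ℝ, 0 < ε → ε ≤ ε₀ →
    (∃ t ∈ Set.Ioo (-ε) (-(ε ^ (1 + β))), γ t ∈ M) ∧
    (∃ t ∈ Set.Ioo (ε ^ (1 + β)) ε, γ t ∈ M)

/-- The point `q₁ = (cos θ_max, 0, sin θ_max)`. -/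
def q1pt (τ : ℝ) : E3 := mkE3 (Real.cos (θmax τ)) 0 (Real.sin (θmax τ))

/-- The point `q₂ = (cos θ_max, 0, −sin θ_max)`. -/
def q2pt (τ : ℝ) : E3 := mkE3 (Real.cos (θmax τ)) 0 (-Real.sin (θmax τ))

/-- The curve `p_s = (cos s, sin s, 0)` along the equator. -/
def pcurve (s : ℝ) : E3 := mkE3 (Real.cos s) (Real.sin s) 0

/-- Geodesic ball in `S²` of radius `r` around `q`. -/
def geoBall (q : E3) (r : ℝ) : Set E3 := {x ∈ Sphere2 | Real.arccos ⟪q, x⟫ < r}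

/-- The set `U_r = (B_r(q₁) ∪ B_r(q₂)) ∖ {q₁, q₂}`. -/
def Uset (τ r : ℝ) : Set E3 := (geoBall (q1pt τ) r ∪ geoBall (q2pt τ) r) \ {q1pt τ, q2pt τ}

/-- The set `I_r(q) = I(q) ∖ U_r`. -/
def Iset (τ r : ℝ) (q : E3) : Set E3 := lightConeI τ q \ Uset τ r

/-- The point of `S²` with latitude `θ` (measured from the equator) and longitude `φ`. -/
def sphPt (θ φ : ℝ) : E3 :=
  mkE3 (Real.cos θ * Real.cos φ) (Real.cos θ * Real.sin φ) (Real.sin θ)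

/-- The restrictions to `Ω` of polynomials of degree at most two on `ℝ³`. -/
def polyRestrictSet (Ω : Set E3) : Set (Ω → ℝ) :=
  {f | ∃ P : MvPolynomial (Fin 3) ℝ, P.totalDegree ≤ 2 ∧
        ∀ x : Ω, f x = MvPolynomial.eval (fun i => (x : E3) i) P}

/-- The space `K(Ω)` of restrictions to `Ω` of polynomials of degree at most two. -/
def KSpace (Ω : Set E3) : Submodule ℝ (Ω → ℝ) := Submodule.span ℝ (polyRestrictSet Ω)

/-- Two-dimensional Hausdorff (surface) measure on `S²` restricted to `Ω`, as a
measure on `Ω`. -/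
def surfΩ (Ω : Set E3) : Measure Ω := Measure.comap Subtype.val (μH[2] : Measure E3)

/-- The bilinear form `B(f,g) = ∫_Ω ∫_Ω D(x,y) f(x) g(y) dμ(x) dμ(y)` on functions on `Ω`. -/
def Bform (τ : ℝ) (Ω : Set E3) (f g : Ω → ℝ) : ℝ :=
  ∫ x, ∫ y, Dfun τ (x : E3) (y : E3) * f x * g y ∂(surfΩ Ω) ∂(surfΩ Ω)

end

lemma aux_integrable (ρ : Measure E3) [IsFiniteMeasure ρ] (h : ρ Sphere2ᶜ = 0)
    (g : E3 → ℝ) (hg : Continuous g) : Integrable g ρ := by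
  have hr : ρ.restrict Sphere2 = ρ := Measure.restrict_eq_self_of_ae_mem (by
    rw [ae_iff]; exact h)
  rw [← hr]
  exact hg.continuousOn.integrableOn_compact (isCompact_sphere (0 : E3) 1)

lemma aux_Lcont (τ : ℝ) : Continuous (fun z : E3 × E3 => Lfun τ z.1 z.2) := by
  unfold Lfun Dfun
  fun_prop

lemma aux_Lcont' (τ : ℝ) (x : E3) : Continuous (fun y : E3 => Lfun τ x y) := by
  unfold Lfun Dfun
  fun_prop

lemma aux_lcont (τ : ℝ) (ρ : Measure E3) [IsFiniteMeasure ρ] (h : ρ Sphere2ᶜ = 0) :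
    Continuous (fun x => ∫ y, Lfun τ x y ∂ρ) := by
  have hr : ρ.restrict Sphere2 = ρ := Measure.restrict_eq_self_of_ae_mem (by
    rw [ae_iff]; exact h)
  have := continuous_parametric_integral_of_continuous (μ := ρ) (f := Lfun τ)
    (s := Sphere2) (aux_Lcont τ) (isCompact_sphere (0 : E3) 1)
  rwa [hr] at this

lemma aux_Lsymm (τ : ℝ) (x y : E3) : Lfun τ x y = Lfun τ y x := by
  unfold Lfun Dfun
  rw [real_inner_comm]

lemma aux_expand (τ : ℝ) (ρ : Measure E3) [IsProbabilityMeasure ρ] (h : ρ Sphere2ᶜ = 0)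
    (x : E3) (e : ℝ) (he : 0 ≤ e) (he1 : e ≤ 1) :
    causalAction τ (ENNReal.ofReal (1 - e) • ρ + ENNReal.ofReal e • Measure.dirac x) =
      (1 - e) ^ 2 * causalAction τ ρ + 2 * e * (1 - e) * (∫ y, Lfun τ x y ∂ρ)
        + e ^ 2 * Lfun τ x x := by
  have key : ∀ g : E3 → ℝ, Continuous g →
      ∫ y, g y ∂(ENNReal.ofReal (1 - e) • ρ + ENNReal.ofReal e • Measure.dirac x) =
      (1 - e) * (∫ y, g y ∂ρ) + e * g x := by
    intro g hg
    have h2 : Integrable g (Measure.dirac x) := integrable_dirac (by simp)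
    rw [integral_add_measure ((aux_integrable ρ h g hg).smul_measure ENNReal.ofReal_ne_top)
      (h2.smul_measure ENNReal.ofReal_ne_top), integral_smul_measure, integral_smul_measure,
      integral_dirac, ENNReal.toReal_ofReal he, ENNReal.toReal_ofReal (by linarith)]
    simp
  have hl := aux_lcont τ ρ h
  have hc : Continuous (fun z => Lfun τ z x) := by
    simp_rw [fun z => aux_Lsymm τ z x]
    exact aux_Lcont' τ x
  unfold causalAction
  simp_rw [fun z => key (Lfun τ z) (aux_Lcont' τ z)]
  have hk : Continuous (fun z => (1 - e) * (∫ y, Lfun τ z y ∂ρ) + e * Lfun τ z x) :=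
    (hl.const_mul _).add (hc.const_mul _)
  rw [key _ hk]
  rw [integral_add ((aux_integrable ρ h _ hl).const_mul _) ((aux_integrable ρ h _ hc).const_mul _),
    integral_const_mul, integral_const_mul]
  simp_rw [fun z => aux_Lsymm τ z x]
  ring

lemma aux_EL1 (τ : ℝ) (ρ : Measure E3) (hmin : IsMinimizer τ ρ) (x : E3) (hx : x ∈ Sphere2) :
    causalAction τ ρ ≤ ∫ y, Lfun τ x y ∂ρ := by
  obtain ⟨hP, hR, h0, hm⟩ := hmin
  by_contra! hlt
  set S := causalAction τ ρ with hS
  set l := ∫ y, Lfun τ x y ∂ρ with hl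
  set B := S - 2 * l + Lfun τ x x with hB
  set d := S - l with hd
  have hdpos : 0 < d := by linarith
  have hBn := abs_nonneg B
  have hden : 0 < d + |B| + 1 := by linarith
  set e := d / (d + |B| + 1) with he
  have he0 : 0 < e := by positivity
  have he1 : e ≤ 1 := by
    rw [he, div_le_one hden]; linarith
  have heq : e * (d + |B| + 1) = d := by rw [he]; field_simp
  have hprob : IsProbabilityMeasure
      (ENNReal.ofReal (1 - e) • ρ + ENNReal.ofReal e • Measure.dirac x) := by
    constructor
    simp only [Measure.add_apply, Measure.smul_apply, measure_univ, smul_eq_mul, mul_one]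
    rw [← ENNReal.ofReal_add (by linarith) he0.le]
    simp
  have hxc : x ∉ Sphere2ᶜ := by simpa using hx
  have hms : MeasurableSet (Sphere2ᶜ) := (Metric.isClosed_sphere (x := (0:E3)) (ε := 1)).measurableSet.compl
  have := hm _ hprob inferInstance (by
    simp only [Measure.add_apply, Measure.smul_apply, smul_eq_mul, h0,
      Measure.dirac_apply' _ hms, Set.indicator_of_notMem hxc, mul_zero, add_zero])
  rw [aux_expand τ ρ h0 x e he0.le he1, ← hS, ← hl] at this
  have h3 : e * (2 * d - e * B) ≤ 0 := by
    rw [hd, hB]; nlinarith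
  have h4 : e * B ≤ e * |B| := mul_le_mul_of_nonneg_left (le_abs_self B) he0.le
  have h5 : 0 < 2 * d - e * B := by nlinarith
  nlinarith [mul_pos he0 h5]

lemma aux_mem (ρ : Measure E3) (h0 : ρ Sphere2ᶜ = 0) (p : E3) (hp : p ∈ msupport ρ) :
    p ∈ Sphere2 := by
  by_contra hn
  have := hp Sphere2ᶜ (Metric.isClosed_sphere (x := (0:E3)) (ε := 1)).isOpen_compl hn
  exact this.ne' h0

lemma aux_EL2 (τ : ℝ) (ρ : Measure E3) (hmin : IsMinimizer τ ρ) (p : E3) (hp : p ∈ msupport ρ) :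
    ∫ y, Lfun τ p y ∂ρ ≤ causalAction τ ρ := by
  have h1 := aux_EL1 τ ρ hmin
  obtain ⟨hP, hR, h0, hm⟩ := hmin
  have hl := aux_lcont τ ρ h0
  by_contra! hlt
  have hae : ∀ᵐ x ∂ρ, x ∈ Sphere2 := by rw [ae_iff]; exact h0
  have hi : Integrable (fun x => (∫ y, Lfun τ x y ∂ρ) - causalAction τ ρ) ρ :=
    (aux_integrable ρ h0 _ hl).sub (integrable_const _)
  have hz : ∫ x, ((∫ y, Lfun τ x y ∂ρ) - causalAction τ ρ) ∂ρ = 0 := by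
    rw [integral_sub (aux_integrable ρ h0 _ hl) (integrable_const _)]
    simp [causalAction]
  rw [integral_eq_zero_iff_of_nonneg_ae (by
    filter_upwards [hae] with x hx
    simpa using h1 x hx) hi] at hz
  have := hp {x | causalAction τ ρ < ∫ y, Lfun τ x y ∂ρ} (isOpen_lt continuous_const hl) hlt
  refine this.ne' ?_
  refine measure_mono_null ?_ (ae_iff.1 hz)
  intro x hx h
  simp only [mem_ofPred_eq, Pi.zero_apply] at hx h
  linarith

lemma aux_ae (ρ : Measure E3) : ∀ᵐ y ∂ρ, y ∈ msupport ρ := by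
  filter_upwards [Measure.support_mem_ae (μ := ρ)] with y hy
  intro U hU hyU
  rw [Measure.mem_support_iff_forall] at hy
  exact hy U (hU.mem_nhds hyU)

lemma aux_closed (ρ : Measure E3) : IsClosed (msupport ρ) := by
  rw [← isOpen_compl_iff, isOpen_iff_forall_mem_open]
  intro x hx
  simp only [msupport, mem_compl_iff, mem_ofPred_eq, not_forall] at hx
  obtain ⟨U, hU, hxU, h⟩ := hx
  exact ⟨U, fun y hy hy' => h (hy' U hU hy), hU, hxU⟩

/-- scalar version of `D` -/
noncomputable def aux_f (τ t : ℝ) : ℝ := (1 / 4) * (1 + t) * (2 - τ ^ 2 * (1 - t))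

lemma aux_strict (τ t a b c s : ℝ) (hτ : 2 < τ) (ht : τ ^ 2 * (1 - t) < 2)
    (hc0 : 0 ≤ c) (hc1 : c ≤ 1) (hs : s ^ 2 = 1 - c ^ 2) (hs0 : 0 < s)
    (hab : t ^ 2 + a ^ 2 + b ^ 2 = 1) :
    aux_f τ (c * t + s * a) + aux_f τ (c * t - s * a) + aux_f τ (c * t + s * b)
      + aux_f τ (c * t - s * b) - 4 * aux_f τ t < 0 := by
  have hτ4 : 4 < τ ^ 2 := by nlinarith
  have ht1 : t ≤ 1 := by nlinarith [sq_nonneg a, sq_nonneg b]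
  have ht2 : 1 / 2 < t := by nlinarith
  have e1 : aux_f τ (c * t + s * a) + aux_f τ (c * t - s * a) + aux_f τ (c * t + s * b)
      + aux_f τ (c * t - s * b) - 4 * aux_f τ t
      = (1 / 4) * (-8 * (1 - c) * t + τ ^ 2 * s ^ 2 * (2 - 6 * t ^ 2)) := by
    unfold aux_f
    have hb : b ^ 2 = 1 - t ^ 2 - a ^ 2 := by linarith
    have hcc : c ^ 2 = 1 - s ^ 2 := by linarith
    ring_nf
    rw [hb, hcc]
    ring
  have e2 : -4 * t + τ ^ 2 * (2 - 6 * t ^ 2) < 0 := by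
    rcases le_or_gt (2 - 6 * t ^ 2) 0 with h | h
    · nlinarith
    · have h1t : 0 < 1 - t := by nlinarith
      have : (τ ^ 2 * (1 - t)) * (2 - 6 * t ^ 2) < 2 * (2 - 6 * t ^ 2) :=
        mul_lt_mul_of_pos_right ht h
      have h6 : (1 - t) * (-4 * t + τ ^ 2 * (2 - 6 * t ^ 2)) < 0 := by nlinarith
      by_contra! h7
      nlinarith [mul_nonneg h1t.le h7]
  have hsc : s ^ 2 / 2 ≤ 1 - c := by nlinarith
  have hs2 : 0 < s ^ 2 := by positivity
  rw [e1]
  have := mul_neg_of_pos_of_neg hs2 e2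
  nlinarith [mul_le_mul_of_nonneg_right hsc (by linarith : (0:ℝ) ≤ t)]

lemma aux_basis (p : E3) (hp : ‖p‖ = 1) : ∃ u v : E3, ‖u‖ = 1 ∧ ‖v‖ = 1 ∧ ⟪p, u⟫ = 0 ∧ ⟪p, v⟫ = 0 ∧
    ∀ y : E3, ⟪p, y⟫ ^ 2 + ⟪u, y⟫ ^ 2 + ⟪v, y⟫ ^ 2 = ‖y‖ ^ 2 := by
  have ho : Orthonormal ℝ (({0} : Set (Fin 3)).domRestrict (fun _ => p)) := by
    constructor
    · intro i; exact hp
    · intro i j hij; exact absurd (Subsingleton.elim i j) hij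
  obtain ⟨b, hb⟩ := ho.exists_orthonormalBasis_extension_of_card_eq (by simp)
  have hb0 : b 0 = p := hb 0 (by simp)
  refine ⟨b 1, b 2, by simp, by simp, ?_, ?_, ?_⟩
  · rw [← hb0]; exact b.orthonormal.2 (by decide)
  · rw [← hb0]; exact b.orthonormal.2 (by decide)
  · intro y
    have := b.sum_sq_inner_right y
    rw [Fin.sum_univ_three, hb0] at this
    exact this

lemma aux_norm (p u : E3) (hp : ‖p‖ = 1) (hu : ‖u‖ = 1) (h : ⟪p, u⟫ = 0) (c s : ℝ)
    (hs : s ^ 2 = 1 - c ^ 2) : c • p + s • u ∈ Sphere2 := by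
  have : ‖c • p + s • u‖ ^ 2 = 1 := by
    rw [norm_add_sq_real, norm_smul, norm_smul, hp, hu, inner_smul_left, inner_smul_right, h]
    simp [hs]
  have h1 : ‖c • p + s • u‖ = 1 := by
    have := norm_nonneg (c • p + s • u)
    nlinarith
  simpa [Sphere2] using h1

set_option maxHeartbeats 1000000 in
theorem stmt_8 (τ : ℝ) (hτ : 2 < τ) (ρ : Measure E3) (hmin : IsMinimizer τ ρ)
    (p : E3) (hp : p ∈ msupport ρ) :
    (lightConeK τ p ∩ msupport ρ).Nonempty := by
  by_contra hne
  have hE1 := aux_EL1 τ ρ hmin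
  have hE2 := aux_EL2 τ ρ hmin p hp
  obtain ⟨hP, hR, h0, -⟩ := hmin
  have hτ4 : 4 < τ ^ 2 := by nlinarith
  set κ := Real.cos (θmax τ) with hκ
  have hκ1 : κ = 1 - 2 / τ ^ 2 := by
    have : 2 / τ ^ 2 ≤ 1 := by rw [div_le_one (by positivity)]; linarith
    have h2 : 0 ≤ 2 / τ ^ 2 := by positivity
    rw [hκ, θmax, Real.cos_arccos (by linarith) (by linarith)]
  have hκ2 : τ ^ 2 * (1 - κ) = 2 := by rw [hκ1]; field_simp; ring
  have hκlt : κ < 1 := by nlinarith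
  have hκ0 : 0 < κ := by nlinarith
  have hpS := aux_mem ρ h0 p hp
  have hpn : ‖p‖ = 1 := by simpa [Sphere2] using hpS
  -- uniform gap
  obtain ⟨δ, hδ, hgap⟩ : ∃ δ > 0, ∀ y ∈ msupport ρ, δ ≤ |⟪p, y⟫ - κ| := by
    have hK : IsCompact (msupport ρ) :=
      (isCompact_sphere (0 : E3) 1).of_isClosed_subset (aux_closed ρ)
        (fun y hy => aux_mem ρ h0 y hy)
    obtain ⟨z, hz, hzm⟩ := hK.exists_isMinOn ⟨p, hp⟩
      (f := fun y => |⟪p, y⟫ - κ|) (by fun_prop)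
    refine ⟨_, ?_, fun y hy => hzm hy⟩
    rw [gt_iff_lt, abs_pos]
    intro h
    exact hne ⟨z, ⟨aux_mem ρ h0 z hz, by linarith⟩, hz⟩
  obtain ⟨u, v, hu, hv, hpu, hpv, hsum⟩ := aux_basis p hpn
  set s := min (δ / 3) (1 / 2) with hs
  have hs0 : 0 < s := by rw [hs]; positivity
  have hs1 : s ≤ δ / 3 := min_le_left _ _
  have hs2 : s ≤ 1 / 2 := min_le_right _ _
  set c := √(1 - s ^ 2) with hc
  have hc0 : 0 ≤ c := Real.sqrt_nonneg _
  have hcs : c ^ 2 = 1 - s ^ 2 := Real.sq_sqrt (by nlinarith)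
  have hc1 : c ≤ 1 := by nlinarith
  have hc2 : 1 - c ≤ s := by nlinarith
  have hsc : s ^ 2 = 1 - c ^ 2 := by linarith
  have hsc' : (-s) ^ 2 = 1 - c ^ 2 := by linarith [neg_sq s]
  have m1 := hE1 _ (aux_norm p u hpn hu hpu c s hsc)
  have m2 := hE1 _ (aux_norm p u hpn hu hpu c (-s) hsc')
  have m3 := hE1 _ (aux_norm p v hpn hv hpv c s hsc)
  have m4 := hE1 _ (aux_norm p v hpn hv hpv c (-s) hsc')
  have hI : ∀ x, Integrable (fun y => Lfun τ x y) ρ := fun x =>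
    aux_integrable ρ h0 _ (aux_Lcont' τ x)
  set g : E3 → ℝ := fun y => 4 * Lfun τ p y - (Lfun τ (c • p + s • u) y
    + Lfun τ (c • p + (-s) • u) y + Lfun τ (c • p + s • v) y + Lfun τ (c • p + (-s) • v) y) with hg
  have hgi : Integrable g ρ :=
    ((hI _).const_mul 4).sub ((((hI _).add (hI _)).add (hI _)).add (hI _))
  have hgint : ∫ y, g y ∂ρ ≤ 0 := by
    have j2 : ∀ x1 x2, Integrable (fun y => Lfun τ x1 y + Lfun τ x2 y) ρ :=
      fun x1 x2 => (hI x1).add (hI x2)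
    have j3 : ∀ x1 x2 x3, Integrable (fun y => Lfun τ x1 y + Lfun τ x2 y + Lfun τ x3 y) ρ :=
      fun x1 x2 x3 => (j2 x1 x2).add (hI x3)
    have j4 : ∀ x1 x2 x3 x4, Integrable
        (fun y => Lfun τ x1 y + Lfun τ x2 y + Lfun τ x3 y + Lfun τ x4 y) ρ :=
      fun x1 x2 x3 x4 => (j3 x1 x2 x3).add (hI x4)
    rw [hg, integral_sub ((hI _).const_mul 4) (j4 _ _ _ _),
      integral_add (j3 _ _ _) (hI _),
      integral_add (j2 _ _) (hI _), integral_add (hI _) (hI _), integral_const_mul]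
    linarith
  -- pointwise
  have hL : ∀ x y, Lfun τ x y = max 0 (aux_f τ ⟪x, y⟫) := fun x y => rfl
  have hlt : ∀ t, κ < t → τ ^ 2 * (1 - t) < 2 := by
    intro t ht
    rw [← hκ2]
    exact mul_lt_mul_of_pos_left (by linarith) (by linarith)
  have hpos : ∀ t, κ < t → 0 ≤ aux_f τ t := by
    intro t ht
    unfold aux_f
    have : 0 ≤ 2 - τ ^ 2 * (1 - t) := by linarith [hlt t ht]
    have : 0 ≤ 1 + t := by linarith
    positivity
  have hneg : ∀ t, -1 ≤ t → t < κ → aux_f τ t ≤ 0 := by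
    intro t ht1 ht
    unfold aux_f
    have : 2 - τ ^ 2 * (1 - t) ≤ 0 := by nlinarith
    exact mul_nonpos_of_nonneg_of_nonpos (by linarith) this
  have hin : ∀ x ∈ Sphere2, ∀ y ∈ Sphere2, -1 ≤ ⟪x, y⟫ ∧ ⟪x, y⟫ ≤ 1 := by
    intro x hx y hy
    have hx : ‖x‖ = 1 := by simpa [Sphere2] using hx
    have hy : ‖y‖ = 1 := by simpa [Sphere2] using hy
    have := abs_real_inner_le_norm x y
    rw [hx, hy, mul_one, abs_le] at this
    exact this
  have hex : ∀ (w y : E3) (r : ℝ), ⟪c • p + r • w, y⟫ = c * ⟪p, y⟫ + r * ⟪w, y⟫ := by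
    intro w y r
    rw [inner_add_left, real_inner_smul_left, real_inner_smul_left]
  have hclose : ∀ t a, |t| ≤ 1 → |a| ≤ 1 → |c * t + s * a - t| < δ ∧ |c * t - s * a - t| < δ := by
    intro t a ht ha
    have e1 : |(1 - c) * t| ≤ s := by
      rw [abs_mul, abs_of_nonneg (by linarith : 0 ≤ 1 - c)]
      exact (mul_le_of_le_one_right (by linarith) ht).trans hc2
    have e2 : |s * a| ≤ s := by
      rw [abs_mul, abs_of_pos hs0]
      exact mul_le_of_le_one_right hs0.le ha
    rw [abs_le] at e1 e2
    constructor <;> rw [abs_lt] <;> constructor <;> linarith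
  have hA : ∀ y ∈ msupport ρ, 0 ≤ g y ∧ (κ < ⟪p, y⟫ → 0 < g y) := by
    intro y hy
    have hyS := aux_mem ρ h0 y hy
    have hyn : ‖y‖ = 1 := by simpa [Sphere2] using hyS
    have hsy := hsum y
    have b1 := hin _ (aux_norm p u hpn hu hpu c s hsc) y hyS
    have b2 := hin _ (aux_norm p u hpn hu hpu c (-s) hsc') y hyS
    have b3 := hin _ (aux_norm p v hpn hv hpv c s hsc) y hyS
    have b4 := hin _ (aux_norm p v hpn hv hpv c (-s) hsc') y hyS
    have b0 := hin p hpS y hyS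
    have bu := hin u (by simpa [Sphere2] using hu) y hyS
    have bv := hin v (by simpa [Sphere2] using hv) y hyS
    have hgy := hgap y hy
    simp only [hg, hL]
    simp only [hex] at b1 b2 b3 b4 ⊢
    rw [hyn] at hsy
    generalize ⟪p, y⟫ = t at *
    generalize ⟪u, y⟫ = a at *
    generalize ⟪v, y⟫ = b at *
    obtain ⟨k1, k2⟩ := hclose t a (abs_le.2 b0) (abs_le.2 bu)
    obtain ⟨k3, k4⟩ := hclose t b (abs_le.2 b0) (abs_le.2 bv)
    rw [abs_lt] at k1 k2 k3 k4
    simp only [neg_mul, ← sub_eq_add_neg] at *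
    rcases lt_or_ge κ t with h | h
    · rw [abs_of_pos (by linarith)] at hgy
      have := aux_strict τ t a b c s hτ (hlt t h) hc0 hc1 hsc hs0 (by linarith)
      rw [max_eq_right (hpos t h), max_eq_right (hpos _ (by linarith)),
        max_eq_right (hpos _ (by linarith)), max_eq_right (hpos _ (by linarith)),
        max_eq_right (hpos _ (by linarith))]
      exact ⟨by linarith, fun _ => by linarith⟩
    · rw [abs_of_nonpos (by linarith)] at hgy
      rw [max_eq_left (hneg t (by linarith) (by linarith)),
        max_eq_left (hneg _ b1.1 (by linarith)), max_eq_left (hneg _ b2.1 (by linarith)),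
        max_eq_left (hneg _ b3.1 (by linarith)), max_eq_left (hneg _ b4.1 (by linarith))]
      exact ⟨by norm_num, fun h' => absurd h' (not_lt.2 h)⟩
  have hae := aux_ae ρ
  have hnn : 0 ≤ᵐ[ρ] g := by
    filter_upwards [hae] with y hy using (hA y hy).1
  have hz := (integral_eq_zero_iff_of_nonneg_ae hnn hgi).1
    (le_antisymm hgint (integral_nonneg_of_ae hnn))
  have hU := hp {y | κ < ⟪p, y⟫} (isOpen_lt continuous_const (by fun_prop)) (by
    simp only [mem_ofPred_eq, real_inner_self_eq_norm_sq, hpn]; linarith)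
  refine hU.ne' ?_
  have hfin : ∀ᵐ y ∂ρ, ¬ (κ < ⟪p, y⟫) := by
    filter_upwards [hae, hz] with y hy hzy h
    have := (hA y hy).2 h
    simp only [Pi.zero_apply] at hzy
    linarith
  rw [ae_iff] at hfin
  simpa using hfin
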